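/- arXiv:1904.05286 — 4 statements merged into one kernel-verified Lean document; each statement's English description precedes it below -/
import Mathlib

section
/- Fix N agents with nonnegative adjacency weights a_{ij} (a_{ii} = 0) and out-degrees dⁱ = Σⱼ a_{ij}. Let fʲ, gʲ : [0,∞) → ℝ be measurable, essentially bounded, and let xʲ : [0,∞) → ℝ be differentiable with ẋʲ(t) = −Σₖ a_{jk}(xʲ(t) − yᵏ(t)) + fʲ(t), where yᵏ(t) = xᵏ(t) + gᵏ(t), and xʲ(0) = rʲ. Fix an agent i and a constant βⁱ ∈ ℝ, and let ζ : [0,∞) → ℝ be differentiable with ζ̇(t) = Σⱼ a_{ij}(yⁱ(t) − yʲ(t)), ζ(0) = −βⁱ, and set ν(t) = ζ(t) + x¹(t). Then for all t ≥ 0: ν(t) − rⁱ = x¹(t) − xⁱ(t) + ∫₀ᵗ (fⁱ(τ) + dⁱ gⁱ(τ)) dτ − βⁱ. Moreover, if x¹(t) − xⁱ(t) → 0 as t → ∞ and ∫₀ᵗ (fⁱ(τ) + dⁱ gⁱ(τ)) dτ → βⁱ as t → ∞, then ν(t) → rⁱ as t → ∞. -/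
open Filter MeasureTheory intervalIntegral

/-- A measurable function that is essentially bounded on `[0, ∞)` is interval integrable
on `[0, t]`. -/
theorem intervalIntegrable_of_measurable_of_ae_bound {u : ℝ → ℝ} (hu : Measurable u) {C : ℝ}
    (hC : ∀ᵐ t : ℝ, 0 ≤ t → |u t| ≤ C) {t : ℝ} (ht : 0 ≤ t) :
    IntervalIntegrable u volume 0 t := by
  rw [intervalIntegrable_iff_integrableOn_Ioc_of_le ht]
  refine Measure.integrableOn_of_bounded (M := C) measure_Ioc_lt_top.ne
    hu.aestronglyMeasurable ?_
  refine (ae_restrict_iff' measurableSet_Ioc).2 ?_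
  filter_upwards [hC] with s hs hmem
  simpa using hs hmem.1.le

/-- Theorem: observer design for an internal malicious agent.
Over a network of `N` agents with nonnegative adjacency weights `a` (zero
diagonal) and out-degrees `dⁱ = Σⱼ a i j`, running the perturbed consensus
dynamics `ẋʲ = −Σₖ a j k (xʲ − yᵏ) + fʲ`, `yᵏ = xᵏ + gᵏ`, `xʲ(0) = rʲ`, with
measurable essentially bounded perturbations: if the internal malicious agent
(agent `1`) runs the observer `ζ̇ = Σⱼ a i j (yⁱ − yʲ)`, `ζ(0) = −βⁱ`,
`ν = ζ + x¹`, then for all `t ≥ 0`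
`ν(t) − rⁱ = x¹(t) − xⁱ(t) + ∫₀ᵗ (fⁱ + dⁱgⁱ) dτ − βⁱ`, and moreover if
`x¹(t) − xⁱ(t) → 0` and `∫₀ᵗ (fⁱ + dⁱgⁱ) dτ → βⁱ` then `ν(t) → rⁱ`. -/
theorem internal_observer_error_and_convergence
    {N : ℕ} (a : Fin N → Fin N → ℝ)
    (ha : ∀ i j, 0 ≤ a i j) (hadiag : ∀ i, a i i = 0)
    (d : Fin N → ℝ) (hd : ∀ i, d i = ∑ j, a i j)
    (f g : Fin N → ℝ → ℝ)
    (hfm : ∀ j, Measurable (f j)) (hgm : ∀ j, Measurable (g j))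
    (hfb : ∀ j, ∃ C : ℝ, ∀ᵐ t : ℝ, 0 ≤ t → |f j t| ≤ C)
    (hgb : ∀ j, ∃ C : ℝ, ∀ᵐ t : ℝ, 0 ≤ t → |g j t| ≤ C)
    (x : Fin N → ℝ → ℝ) (y : Fin N → ℝ → ℝ)
    (hy : ∀ k t, y k t = x k t + g k t)
    (hx : ∀ j, ∀ t : ℝ, 0 ≤ t →
        HasDerivAt (x j) (-(∑ k, a j k * (x j t - y k t)) + f j t) t)
    (r : Fin N → ℝ) (hr : ∀ j, x j 0 = r j)
    (agent1 i : Fin N) (βi : ℝ)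
    (ζ : ℝ → ℝ)
    (hζ : ∀ t : ℝ, 0 ≤ t → HasDerivAt ζ (∑ j, a i j * (y i t - y j t)) t)
    (hζ0 : ζ 0 = -βi)
    (ν : ℝ → ℝ) (hν : ∀ t, ν t = ζ t + x agent1 t) :
    (∀ t : ℝ, 0 ≤ t →
        ν t - r i =
          x agent1 t - x i t + (∫ τ in (0:ℝ)..t, (f i τ + d i * g i τ)) - βi)
    ∧ (Tendsto (fun t : ℝ => x agent1 t - x i t) atTop (nhds 0) →
        Tendsto (fun t : ℝ => ∫ τ in (0:ℝ)..t, (f i τ + d i * g i τ))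
          atTop (nhds βi) →
        Tendsto ν atTop (nhds (r i))) := by
  have hderiv : ∀ t : ℝ, 0 ≤ t →
      HasDerivAt (fun s => ζ s + x i s) (f i t + d i * g i t) t := by
    intro t ht
    have hsum : ∑ j, a i j * (y i t - y j t) =
        (∑ j, a i j * (x i t - y j t)) + d i * g i t := by
      rw [hd i, Finset.sum_mul, ← Finset.sum_add_distrib]
      refine Finset.sum_congr rfl fun j _ => ?_
      rw [hy i t]
      ring
    refine ((hζ t ht).add (hx i t ht)).congr_deriv ?_
    rw [hsum]
    ring
  have herr : ∀ t : ℝ, 0 ≤ t →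
      ν t - r i =
        x agent1 t - x i t + (∫ τ in (0:ℝ)..t, (f i τ + d i * g i τ)) - βi := by
    intro t ht
    obtain ⟨Cf, hCf⟩ := hfb i
    obtain ⟨Cg, hCg⟩ := hgb i
    have hint : IntervalIntegrable (fun τ => f i τ + d i * g i τ) volume 0 t :=
      (intervalIntegrable_of_measurable_of_ae_bound (hfm i) hCf ht).add
        ((intervalIntegrable_of_measurable_of_ae_bound (hgm i) hCg ht).const_mul (d i))
    rw [integral_eq_sub_of_hasDerivAt
      (fun s hs => hderiv s (by rw [Set.uIcc_of_le ht] at hs; exact hs.1)) hint,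
      hν, hζ0, hr]
    ring
  refine ⟨herr, fun hx1 hI => ?_⟩
  have hlim := ((hx1.add hI).sub_const βi).add_const (r i)
  rw [zero_add, sub_self, zero_add] at hlim
  refine hlim.congr' ?_
  filter_upwards [eventually_ge_atTop 0] with t ht
  rw [← herr t ht, sub_add_cancel]
end

section
/- Fix N agents with nonnegative adjacency weights a_{ij} (a_{ii} = 0) and out-degrees dⁱ = Σⱼ a_{ij}. Let fʲ, gʲ : [0,∞) → ℝ be measurable, essentially bounded, and let xʲ : [0,∞) → ℝ be differentiable with ẋʲ(t) = −Σₖ a_{jk}(xʲ(t) − yᵏ(t)) + fʲ(t), where yᵏ(t) = xᵏ(t) + gᵏ(t), and xʲ(0) = rʲ. Fix an agent i and constants βⁱ, α, η₀ ∈ ℝ. Let ζ, η : [0,∞) → ℝ be differentiable with ζ̇(t) = Σⱼ a_{ij}(yⁱ(t) − yʲ(t)), ζ(0) = −βⁱ − α, and η̇(t) = −η(t) + yⁱ(t), η(0) = η₀, and set ν(t) = ζ(t) + η(t). Then for all t ≥ 0: ν(t) − rⁱ = η(t) − xⁱ(t) + ∫₀ᵗ (fⁱ(τ) + dⁱ gⁱ(τ))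 dτ − βⁱ − α, where η(t) = e^{−t} η₀ + ∫₀ᵗ e^{−(t−τ)} xⁱ(τ) dτ + ∫₀ᵗ e^{−(t−τ)} gⁱ(τ) dτ. Moreover, if xⁱ(t) converges to a finite limit as t → ∞, ∫₀ᵗ (fⁱ(τ) + dⁱ gⁱ(τ)) dτ → βⁱ, and ∫₀ᵗ e^{−(t−τ)} gⁱ(τ) dτ → α as t → ∞, then ν(t) → rⁱ as t → ∞. -/
open Filter MeasureTheory intervalIntegral

/-- A measurable function that is essentially bounded on `[0, ∞)` is integrable on `[0, t]`. -/
theorem intervalIntegrable_of_ae_abs_le {u : ℝ → ℝ} (hum : Measurable u) {C : ℝ}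
    (hub : ∀ᵐ t : ℝ, 0 ≤ t → |u t| ≤ C) {t : ℝ} (ht : 0 ≤ t) :
    IntervalIntegrable u volume 0 t := by
  refine (intervalIntegrable_const (c := C)).mono_fun' hum.aestronglyMeasurable ?_
  rw [Set.uIoc_of_le ht]
  refine (ae_restrict_iff' measurableSet_Ioc).2 ?_
  filter_upwards [hub] with s hs hsm
  exact hs hsm.1.le

theorem integral_exp_neg_sub (a t : ℝ) :
    ∫ τ in a..t, Real.exp (-(t - τ)) = 1 - Real.exp (-(t - a)) := by
  have h : ∀ s ∈ Set.uIcc a t,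
      HasDerivAt (fun τ => Real.exp (-(t - τ))) (Real.exp (-(t - s))) s := by
    intro s _
    simpa using (((hasDerivAt_id s).const_sub t).neg).exp
  have hexp : Continuous fun τ : ℝ => Real.exp (-(t - τ)) := by fun_prop
  rw [integral_eq_sub_of_hasDerivAt h (hexp.intervalIntegrable _ _)]
  simp

/-- Convolution with the exponential kernel of a signal vanishing at infinity vanishes at
infinity. -/
theorem tendsto_integral_exp_mul_zero {h : ℝ → ℝ} (hc : ContinuousOn h (Set.Ici 0))
    (hlim : Tendsto h atTop (nhds 0)) :
    Tendsto (fun t : ℝ => ∫ τ in (0:ℝ)..t, Real.exp (-(t - τ)) * h τ) atTop (nhds 0) := by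
  have hint : ∀ t a b : ℝ, 0 ≤ a → 0 ≤ b →
      IntervalIntegrable (fun τ => Real.exp (-(t - τ)) * h τ) volume a b := by
    intro t a b ha hb
    refine ContinuousOn.intervalIntegrable (ContinuousOn.mul (by fun_prop) (hc.mono ?_))
    intro s hs
    exact (le_min ha hb).trans hs.1
  rw [Metric.tendsto_atTop]
  intro ε hε
  obtain ⟨T₀, hT₀⟩ := Metric.tendsto_atTop.1 hlim (ε / 2) (half_pos hε)
  set T := max T₀ 0
  have hT : 0 ≤ T := le_max_right _ _
  have hhead : Tendsto (fun t : ℝ => Real.exp (-t) * ∫ τ in (0:ℝ)..T, Real.exp τ * h τ)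
      atTop (nhds 0) := by
    simpa using (Real.tendsto_exp_neg_atTop_nhds_zero).mul_const
      (∫ τ in (0:ℝ)..T, Real.exp τ * h τ)
  obtain ⟨T₁, hT₁⟩ := Metric.tendsto_atTop.1 hhead (ε / 2) (half_pos hε)
  refine ⟨max T T₁, fun t ht => ?_⟩
  have htT : T ≤ t := (le_max_left _ _).trans ht
  have hh := hT₁ t ((le_max_right _ _).trans ht)
  have hsplit := integral_add_adjacent_intervals (hint t 0 T le_rfl hT)
    (hint t T t hT (hT.trans htT))
  have hfirst : ∫ τ in (0:ℝ)..T, Real.exp (-(t - τ)) * h τ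
      = Real.exp (-t) * ∫ τ in (0:ℝ)..T, Real.exp τ * h τ := by
    rw [← intervalIntegral.integral_const_mul]
    congr 1 with τ
    rw [← mul_assoc, ← Real.exp_add]
    ring_nf
  have htail : ‖∫ τ in T..t, Real.exp (-(t - τ)) * h τ‖
      ≤ ∫ τ in T..t, Real.exp (-(t - τ)) * (ε / 2) := by
    have hbound : Continuous fun τ : ℝ => Real.exp (-(t - τ)) * (ε / 2) := by fun_prop
    refine intervalIntegral.norm_integral_le_of_norm_le htT
      (Eventually.of_forall fun τ hτ => ?_) (hbound.intervalIntegrable _ _)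
    have := hT₀ τ ((le_max_left _ _).trans hτ.1.le)
    rw [dist_zero_right] at this
    rw [norm_mul, Real.norm_of_nonneg (Real.exp_pos _).le]
    gcongr
  rw [intervalIntegral.integral_mul_const, integral_exp_neg_sub] at htail
  rw [dist_zero_right] at hh ⊢
  rw [← hsplit, hfirst]
  have hpos := mul_pos (Real.exp_pos (-(t - T))) (half_pos hε)
  exact (norm_add_le _ _).trans_lt (by linarith)

/-- Convolution with the exponential kernel preserves limits at infinity. -/
theorem tendsto_integral_exp_mul {x : ℝ → ℝ} {c : ℝ} (hc : ContinuousOn x (Set.Ici 0))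
    (hlim : Tendsto x atTop (nhds c)) :
    Tendsto (fun t : ℝ => ∫ τ in (0:ℝ)..t, Real.exp (-(t - τ)) * x τ) atTop (nhds c) := by
  have h0 := tendsto_integral_exp_mul_zero (h := fun τ => x τ - c)
    (hc.sub continuousOn_const) (by simpa using hlim.sub_const c)
  have h1 := h0.add (((Real.tendsto_exp_neg_atTop_nhds_zero).const_sub 1).mul_const c)
  simp only [sub_zero, one_mul, zero_add] at h1
  refine h1.congr' ?_
  filter_upwards [eventually_ge_atTop 0] with t ht
  have hexp : Continuous fun τ : ℝ => Real.exp (-(t - τ)) := by fun_prop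
  have hx : ContinuousOn x (Set.uIcc 0 t) := by
    rw [Set.uIcc_of_le ht]
    exact hc.mono Set.Icc_subset_Ici_self
  simp_rw [mul_sub]
  rw [intervalIntegral.integral_sub (hx.intervalIntegrable.continuousOn_mul hexp.continuousOn)
    ((hexp.intervalIntegrable _ _).mul_const c),
    intervalIntegral.integral_mul_const, integral_exp_neg_sub]
  simp

/-- Variation of constants for the first-order filter with input `v` on `[0, t]`. -/
theorem eq_exp_mul_add_integral_of_hasDerivAt {u v : ℝ → ℝ} {t : ℝ} (ht : 0 ≤ t)
    (hu : ∀ s : ℝ, 0 ≤ s → HasDerivAt u (-u s + v s) s)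
    (hv : IntervalIntegrable v volume 0 t) :
    u t = Real.exp (-t) * u 0 + ∫ τ in (0:ℝ)..t, Real.exp (-(t - τ)) * v τ := by
  have hexp : Continuous fun τ : ℝ => Real.exp (-(t - τ)) := by fun_prop
  have hderiv : ∀ s ∈ Set.uIcc 0 t,
      HasDerivAt (fun τ => Real.exp (-(t - τ)) * u τ) (Real.exp (-(t - s)) * v s) s := by
    intro s hs
    rw [Set.uIcc_of_le ht] at hs
    have he : HasDerivAt (fun τ => Real.exp (-(t - τ))) (Real.exp (-(t - s))) s := by
      simpa using (((hasDerivAt_id s).const_sub t).neg).exp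
    exact (he.mul (hu s hs.1)).congr_deriv (by ring)
  have := integral_eq_sub_of_hasDerivAt hderiv (hv.continuousOn_mul hexp.continuousOn)
  simp only [sub_self, neg_zero, Real.exp_zero, one_mul, sub_zero] at this
  linarith

/-- Theorem: observer design for an external malicious agent.
Over a network of `N` agents with nonnegative adjacency weights `a` (zero
diagonal) and out-degrees `dⁱ = Σⱼ a i j`, running the perturbed consensus
dynamics `ẋʲ = −Σₖ a j k (xʲ − yᵏ) + fʲ`, `yᵏ = xᵏ + gᵏ`, `xʲ(0) = rʲ`, with
measurable essentially bounded perturbations: if an external malicious agent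
runs the observer `ζ̇ = Σⱼ a i j (yⁱ − yʲ)`, `ζ(0) = −βⁱ − α`,
`η̇ = −η + yⁱ`, `η(0) = η₀`, `ν = ζ + η`, then for all `t ≥ 0`
`ν(t) − rⁱ = η(t) − xⁱ(t) + ∫₀ᵗ (fⁱ + dⁱgⁱ) dτ − βⁱ − α` where
`η(t) = e^{−t}η₀ + ∫₀ᵗ e^{−(t−τ)}xⁱ dτ + ∫₀ᵗ e^{−(t−τ)}gⁱ dτ`; moreover if
`xⁱ(t)` converges, `∫₀ᵗ (fⁱ + dⁱgⁱ) dτ → βⁱ` and `∫₀ᵗ e^{−(t−τ)}gⁱ dτ → α`,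
then `ν(t) → rⁱ`. -/
theorem external_observer_error_and_convergence
    {N : ℕ} (a : Fin N → Fin N → ℝ)
    (ha : ∀ i j, 0 ≤ a i j) (hadiag : ∀ i, a i i = 0)
    (d : Fin N → ℝ) (hd : ∀ i, d i = ∑ j, a i j)
    (f g : Fin N → ℝ → ℝ)
    (hfm : ∀ j, Measurable (f j)) (hgm : ∀ j, Measurable (g j))
    (hfb : ∀ j, ∃ C : ℝ, ∀ᵐ t : ℝ, 0 ≤ t → |f j t| ≤ C)
    (hgb : ∀ j, ∃ C : ℝ, ∀ᵐ t : ℝ, 0 ≤ t → |g j t| ≤ C)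
    (x : Fin N → ℝ → ℝ) (y : Fin N → ℝ → ℝ)
    (hy : ∀ k t, y k t = x k t + g k t)
    (hx : ∀ j, ∀ t : ℝ, 0 ≤ t →
        HasDerivAt (x j) (-(∑ k, a j k * (x j t - y k t)) + f j t) t)
    (r : Fin N → ℝ) (hr : ∀ j, x j 0 = r j)
    (i : Fin N) (βi α η₀ : ℝ)
    (ζ η : ℝ → ℝ)
    (hζ : ∀ t : ℝ, 0 ≤ t → HasDerivAt ζ (∑ j, a i j * (y i t - y j t)) t)
    (hζ0 : ζ 0 = -βi - α)
    (hη : ∀ t : ℝ, 0 ≤ t → HasDerivAt η (-η t + y i t) t)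
    (hη0 : η 0 = η₀)
    (ν : ℝ → ℝ) (hν : ∀ t, ν t = ζ t + η t) :
    (∀ t : ℝ, 0 ≤ t →
        (ν t - r i =
            η t - x i t + (∫ τ in (0:ℝ)..t, (f i τ + d i * g i τ)) - βi - α)
        ∧ (η t = Real.exp (-t) * η₀
            + (∫ τ in (0:ℝ)..t, Real.exp (-(t - τ)) * x i τ)
            + (∫ τ in (0:ℝ)..t, Real.exp (-(t - τ)) * g i τ)))
    ∧ ((∃ c : ℝ, Tendsto (x i) atTop (nhds c)) →
        Tendsto (fun t : ℝ => ∫ τ in (0:ℝ)..t, (f i τ + d i * g i τ))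
          atTop (nhds βi) →
        Tendsto (fun t : ℝ => ∫ τ in (0:ℝ)..t, Real.exp (-(t - τ)) * g i τ)
          atTop (nhds α) →
        Tendsto ν atTop (nhds (r i))) := by
  have hxc : ContinuousOn (x i) (Set.Ici 0) := fun s hs =>
    (hx i s hs).continuousAt.continuousWithinAt
  obtain ⟨Cf, hCf⟩ := hfb i
  obtain ⟨Cg, hCg⟩ := hgb i
  have hfi : ∀ t : ℝ, 0 ≤ t → IntervalIntegrable (f i) volume 0 t :=
    fun t ht => intervalIntegrable_of_ae_abs_le (hfm i) hCf ht
  have hgi : ∀ t : ℝ, 0 ≤ t → IntervalIntegrable (g i) volume 0 t :=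
    fun t ht => intervalIntegrable_of_ae_abs_le (hgm i) hCg ht
  have hxi : ∀ t : ℝ, 0 ≤ t → IntervalIntegrable (x i) volume 0 t := by
    intro t ht
    refine ContinuousOn.intervalIntegrable (hxc.mono ?_)
    rw [Set.uIcc_of_le ht]
    exact Set.Icc_subset_Ici_self
  have herr : ∀ t : ℝ, 0 ≤ t → ν t - r i =
      η t - x i t + (∫ τ in (0:ℝ)..t, (f i τ + d i * g i τ)) - βi - α := by
    intro t ht
    have hderiv : ∀ s ∈ Set.uIcc 0 t,
        HasDerivAt (fun τ => ζ τ + x i τ) (f i s + d i * g i s) s := by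
      intro s hs
      rw [Set.uIcc_of_le ht] at hs
      refine ((hζ s hs.1).add (hx i s hs.1)).congr_deriv ?_
      have hsum : d i * g i s
          = ∑ j, a i j * (y i s - y j s) - ∑ k, a i k * (x i s - y k s) := by
        rw [hd, Finset.sum_mul, ← Finset.sum_sub_distrib]
        refine Finset.sum_congr rfl fun j _ => ?_
        rw [hy i s]
        ring
      rw [hsum]
      ring
    rw [integral_eq_sub_of_hasDerivAt hderiv ((hfi t ht).add ((hgi t ht).const_mul (d i))),
      hν, hζ0, hr]
    ring
  have hηeq : ∀ t : ℝ, 0 ≤ t → η t = Real.exp (-t) * η₀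
      + (∫ τ in (0:ℝ)..t, Real.exp (-(t - τ)) * x i τ)
      + (∫ τ in (0:ℝ)..t, Real.exp (-(t - τ)) * g i τ) := by
    intro t ht
    have hexp : Continuous fun τ : ℝ => Real.exp (-(t - τ)) := by fun_prop
    have hyi : y i = fun τ => x i τ + g i τ := funext (hy i)
    rw [eq_exp_mul_add_integral_of_hasDerivAt ht hη (hyi ▸ (hxi t ht).add (hgi t ht)), hη0,
      add_assoc, ← intervalIntegral.integral_add
        ((hxi t ht).continuousOn_mul hexp.continuousOn)
        ((hgi t ht).continuousOn_mul hexp.continuousOn)]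
    simp_rw [hy, mul_add]
  refine ⟨fun t ht => ⟨herr t ht, hηeq t ht⟩, ?_⟩
  rintro ⟨c, hc⟩ hβ hα
  have hlim := ((((((Real.tendsto_exp_neg_atTop_nhds_zero.mul_const η₀).add
    (tendsto_integral_exp_mul hxc hc)).add hα).sub hc).add hβ).sub_const (βi + α)).add_const (r i)
  have hval : 0 * η₀ + c + α - c + βi - (βi + α) + r i = r i := by ring
  rw [hval] at hlim
  refine hlim.congr' ?_
  filter_upwards [eventually_ge_atTop 0] with t ht
  have h1 := herr t ht
  have h2 := hηeq t ht
  linarith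
end

section
/- Fix N agents with nonnegative adjacency weights a_{jk} (a_{jj} = 0) and out-degrees dʲ = Σₖ a_{jk}. Let f, g : [0,∞) → ℝᴺ be measurable essentially bounded and let x be differentiable with ẋʲ(t) = −Σₖ a_{jk}(xʲ(t) − yᵏ(t)) + fʲ(t), y = x + g. Fix two distinct agents i, k, constants b, d ∈ ℝ, and let x′ be the solution of the same dynamics with modified data: x′(0) agrees with x(0) except xⁱ′(0) = xⁱ(0) − b and xᵏ′(0) = xᵏ(0) + b; f′ agrees with f except fⁱ′(t) = fⁱ(t) + d·b·e^{−(dⁱ+d)t} and fᵏ′(t) = fᵏ(t) − d·b·e^{−(dᵏ+d)t}; g′ agrees with g except gⁱ′(t) = gⁱ(t) + b·e^{−(dⁱ+d)t} and gᵏ′(t) = gᵏ(t) − b·e^{−(dᵏ+d)t}; with output y′ = x′ + g′. Then yʲ′(t) = yʲ(t) for all t ≥ 0 and all agents j ∈ {1,…,N}. -/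
open Filter MeasureTheory

/-- A solution of a autonomous bounded linear ODE starting at the origin stays there. -/
theorem eq_zero_of_hasDerivAt_linear {E : Type*} [NormedAddCommGroup E] [NormedSpace ℝ E]
    (A : E →L[ℝ] E) {e : ℝ → E} (he : ∀ t, 0 ≤ t → HasDerivAt e (A (e t)) t)
    (he0 : e 0 = 0) {t : ℝ} (ht : 0 ≤ t) : e t = 0 := by
  have h : Set.EqOn e (fun _ => 0) (Set.Icc 0 t) :=
    ODE_solution_unique (v := fun _ => A) (K := ‖A‖₊) (fun _ => A.lipschitz)
      (fun s hs => (he s hs.1).continuousAt.continuousWithinAt)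
      (fun s hs => (he s hs.1).hasDerivWithinAt)
      continuousOn_const
      (fun s _ => by simpa using hasDerivWithinAt_const s (Set.Ici s) (0 : E)) he0
  exact h ⟨ht, le_rfl⟩

/-- indistinguishability construction for a concealed `βⁱ`.
Over a network of `N` agents with nonnegative adjacency weights `a` (zero
diagonal) and out-degrees `dʲ = Σₖ a j k`, running the perturbed consensus
dynamics `ẋʲ = −Σₖ a j k (xʲ − yᵏ) + fʲ`, `y = x + g`: for two distinct agents
`i, k₀` and constants `b, c ∈ ℝ`, the alternative execution `x′` with modified
data `xⁱ′(0) = xⁱ(0) − b`, `xᵏ′(0) = xᵏ(0) + b`,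
`fⁱ′(t) = fⁱ(t) + c·b·e^{−(dⁱ+c)t}`, `fᵏ′(t) = fᵏ(t) − c·b·e^{−(dᵏ+c)t}`,
`gⁱ′(t) = gⁱ(t) + b·e^{−(dⁱ+c)t}`, `gᵏ′(t) = gᵏ(t) − b·e^{−(dᵏ+c)t}` (all other
data unchanged) produces identical outputs: `yʲ′(t) = yʲ(t)` for all `t ≥ 0`
and all agents `j`. -/
theorem indistinguishable_outputs_beta_transfer
    {N : ℕ} (a : Fin N → Fin N → ℝ)
    (ha : ∀ i j, 0 ≤ a i j) (hadiag : ∀ i, a i i = 0)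
    (d : Fin N → ℝ) (hd : ∀ i, d i = ∑ j, a i j)
    (f g f' g' : Fin N → ℝ → ℝ)
    (hfm : ∀ j, Measurable (f j)) (hgm : ∀ j, Measurable (g j))
    (hfb : ∀ j, ∃ C : ℝ, ∀ᵐ t : ℝ, 0 ≤ t → |f j t| ≤ C)
    (hgb : ∀ j, ∃ C : ℝ, ∀ᵐ t : ℝ, 0 ≤ t → |g j t| ≤ C)
    (i k₀ : Fin N) (hik : i ≠ k₀) (b c : ℝ)
    (hf'other : ∀ j, j ≠ i → j ≠ k₀ → ∀ t, f' j t = f j t)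
    (hg'other : ∀ j, j ≠ i → j ≠ k₀ → ∀ t, g' j t = g j t)
    (hf'i : ∀ t, f' i t = f i t + c * b * Real.exp (-(d i + c) * t))
    (hf'k : ∀ t, f' k₀ t = f k₀ t - c * b * Real.exp (-(d k₀ + c) * t))
    (hg'i : ∀ t, g' i t = g i t + b * Real.exp (-(d i + c) * t))
    (hg'k : ∀ t, g' k₀ t = g k₀ t - b * Real.exp (-(d k₀ + c) * t))
    (x x' : Fin N → ℝ → ℝ) (y y' : Fin N → ℝ → ℝ)
    (hy : ∀ j t, y j t = x j t + g j t)
    (hy' : ∀ j t, y' j t = x' j t + g' j t)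
    (hx : ∀ j, ∀ t : ℝ, 0 ≤ t →
        HasDerivAt (x j) (-(∑ k, a j k * (x j t - y k t)) + f j t) t)
    (hx' : ∀ j, ∀ t : ℝ, 0 ≤ t →
        HasDerivAt (x' j) (-(∑ k, a j k * (x' j t - y' k t)) + f' j t) t)
    (hx'0other : ∀ j, j ≠ i → j ≠ k₀ → x' j 0 = x j 0)
    (hx'0i : x' i 0 = x i 0 - b)
    (hx'0k : x' k₀ 0 = x k₀ 0 + b) :
    ∀ j, ∀ t : ℝ, 0 ≤ t → y' j t = y j t := by
  obtain ⟨s, hsi, hsk, hso⟩ : ∃ s : Fin N → ℝ, s i = b ∧ s k₀ = -b ∧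
      ∀ j, j ≠ i → j ≠ k₀ → s j = 0 :=
    ⟨fun j => if j = i then b else if j = k₀ then -b else 0, by simp, by simp [hik.symm],
      fun j hi hk => by simp [hi, hk]⟩
  have hf' : ∀ j t, f' j t = f j t + c * s j * Real.exp (-(d j + c) * t) := by
    intro j t
    by_cases hi : j = i
    · subst hi; rw [hf'i, hsi]
    by_cases hk : j = k₀
    · subst hk; rw [hf'k, hsk]; ring
    · rw [hf'other j hi hk, hso j hi hk]; ring
  have hg' : ∀ j t, g' j t = g j t + s j * Real.exp (-(d j + c) * t) := by
    intro j t
    by_cases hi : j = i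
    · subst hi; rw [hg'i, hsi]
    by_cases hk : j = k₀
    · subst hk; rw [hg'k, hsk]; ring
    · rw [hg'other j hi hk, hso j hi hk]; ring
  have hx'0 : ∀ j, x' j 0 = x j 0 - s j := by
    intro j
    by_cases hi : j = i
    · subst hi; rw [hx'0i, hsi]
    by_cases hk : j = k₀
    · subst hk; rw [hx'0k, hsk]; ring
    · rw [hx'0other j hi hk, hso j hi hk]; ring
  have hsum : ∀ (j : Fin N) (u : ℝ) (z : Fin N → ℝ),
      ∑ k, a j k * (u - z k) = d j * u - ∑ k, a j k * z k := by
    intro j u z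
    simp only [mul_sub, Finset.sum_sub_distrib, ← Finset.sum_mul, hd]
  let A : (Fin N → ℝ) →L[ℝ] (Fin N → ℝ) :=
    (Matrix.mulVecLin (Matrix.of a - Matrix.diagonal d)).toContinuousLinearMap
  have hA : ∀ z j, A z j = ∑ k, a j k * z k - d j * z j := by
    intro z j
    simp only [A, LinearMap.coe_toContinuousLinearMap', Matrix.mulVecLin_apply, Matrix.sub_mulVec,
      Pi.sub_apply, Matrix.mulVec_diagonal]
    rfl
  have hdiff : ∀ j t, y' j t - y j t = x' j t - x j t + s j * Real.exp (-(d j + c) * t) := by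
    intro j t
    rw [hy, hy', hg']; ring
  have hderiv : ∀ t, 0 ≤ t → HasDerivAt (fun τ j => y' j τ - y j τ)
      (A fun j => y' j t - y j t) t := by
    intro t ht
    refine hasDerivAt_pi.2 fun j => ?_
    have hexp : HasDerivAt (fun τ => Real.exp (-(d j + c) * τ))
        (Real.exp (-(d j + c) * t) * -(d j + c)) t := by
      simpa using ((hasDerivAt_id t).const_mul (-(d j + c))).exp
    have h := ((hx' j t ht).sub (hx j t ht)).add (hexp.const_mul (s j))
    rw [funext (hdiff j)]
    refine h.congr_deriv ?_
    have hsplit : ∑ k, a j k * (y' k t - y k t) =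
        ∑ k, a j k * y' k t - ∑ k, a j k * y k t := by
      simp only [mul_sub, Finset.sum_sub_distrib]
    rw [hA, hsplit, hdiff, hsum j _ fun k => y' k t, hsum j _ fun k => y k t, hf']
    ring
  have hzero : (fun j => y' j 0 - y j 0) = 0 := by
    funext j
    rw [hdiff, hx'0]
    simp
  intro j t ht
  exact sub_eq_zero.1 (congrFun (eq_zero_of_hasDerivAt_linear A hderiv hzero ht) j)
end

section
/- Let the index set of an island of agent 1 be split into blocks (1, V₂, V₃, V₄) and let the island's out-Laplacian L₁ = [[d¹₁, −A₁₂, 0, −A₁₄], [−A₂₁, D₂₂ − A₂₂, −A₂₃, −A₂₄], [−A₃₁, −A₃₂, D₃₃ − A₃₃, 0], [−A₄₁, −A₄₂, 0, D₄₄ − A₄₄]] satisfy 1ᵀL₁ = 0 (weight-balanced), where the A-blocks are nonnegative, Dₗₗ are the diagonal out-degree blocks of the full network, and d¹₁ is the out-degree of agent 1 inside the island. Suppose the island states evolve as [η̇; ẋ₂; ẋ₃; ẋ₄] = −L₁ [y¹; y₂; y₃; y₄] + [0; f₂ + D₂₂g₂; f₃ + D₃₃g₃; f₄ + D₄₄g₄],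 where yₗ = xₗ + gₗ, y¹ = x¹ + g¹, with xₗ(0) = rₗ, and where η(0) = −Σ_{j∈V₂∪V₃∪V₄} βʲ. For each i ∈ V₄ let ζᵢ be differentiable with ζ̇ᵢ(t) equal to the i-th row of the network dynamics relation Σⱼ a_{ij}(yⁱ − yʲ) and ζᵢ(0) = −βⁱ. Let n₂₃ = |V₂| + |V₃| and μ(t) = (η(t) − Σ_{i∈V₄} ζᵢ(t))/n₂₃ + x¹(t). Assume for each agent j in the island ∫₀ᵗ (fʲ(τ) + dʲ gʲ(τ)) dτ → βʲ as t → ∞, and assume all agent states xʲ(t) (including x¹(t)) converge to a common limit as t → ∞. Then μ(t) → (1/n₂₃) Σ_{j∈V₂∪V₃} rʲ as t → ∞. -/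
open Filter MeasureTheory intervalIntegral Matrix

/-- Index set of the island of agent 1, split as `(1, V₂, V₃, V₄)`. -/
abbrev IslandIdx (n₂ n₃ n₄ : ℕ) : Type := Unit ⊕ Fin n₂ ⊕ Fin n₃ ⊕ Fin n₄

/-- Agent 1. -/
def isl1 {n₂ n₃ n₄ : ℕ} : IslandIdx n₂ n₃ n₄ := Sum.inl ()

/-- Inclusion of block `V₂`. -/
def isl2 {n₂ n₃ n₄ : ℕ} (i : Fin n₂) : IslandIdx n₂ n₃ n₄ := Sum.inr (Sum.inl i)

/-- Inclusion of block `V₃`. -/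
def isl3 {n₂ n₃ n₄ : ℕ} (i : Fin n₃) : IslandIdx n₂ n₃ n₄ :=
  Sum.inr (Sum.inr (Sum.inl i))

/-- Inclusion of block `V₄`. -/
def isl4 {n₂ n₃ n₄ : ℕ} (i : Fin n₄) : IslandIdx n₂ n₃ n₄ :=
  Sum.inr (Sum.inr (Sum.inr i))

/-- A measurable real function that is essentially bounded on `[0, ∞)` is interval integrable on
every interval `[0, t]` with `0 ≤ t`. -/
lemma intervalIntegrable_of_ae_bound_nonneg {h : ℝ → ℝ} (hm : Measurable h) {C : ℝ}
    (hb : ∀ᵐ t : ℝ, 0 ≤ t → ‖h t‖ ≤ C) {t : ℝ} (ht : 0 ≤ t) :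
    IntervalIntegrable h volume 0 t := by
  rw [intervalIntegrable_iff_integrableOn_Ioc_of_le ht]
  refine IntegrableOn.of_bound measure_Ioc_lt_top hm.aestronglyMeasurable C ?_
  rw [ae_restrict_iff' measurableSet_Ioc]
  filter_upwards [hb] with s hs hst using hs hst.1.le

/-- A function whose derivative on `[0, ∞)` is interval integrable converges at infinity to its
initial value plus the limit of the integrals of its derivative. -/
lemma tendsto_of_hasDerivAt_of_tendsto_integral {F h : ℝ → ℝ} {b : ℝ}
    (hF : ∀ t, 0 ≤ t → HasDerivAt F (h t) t)
    (hi : ∀ t, 0 ≤ t → IntervalIntegrable h volume 0 t)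
    (hb : Tendsto (fun t : ℝ => ∫ τ in (0:ℝ)..t, h τ) atTop (nhds b)) :
    Tendsto F atTop (nhds (F 0 + b)) := by
  refine (hb.const_add (F 0)).congr' ?_
  filter_upwards [eventually_ge_atTop 0] with t ht
  rw [integral_eq_sub_of_hasDerivAt (fun s hs => hF s ?_) (hi t ht)]
  · ring
  · rw [Set.uIcc_of_le ht] at hs
    exact hs.1

/-- The sum over all island agents other than agent 1, split into blocks. -/
lemma sum_erase_isl1 {n₂ n₃ n₄ : ℕ} (v : IslandIdx n₂ n₃ n₄ → ℝ) :
    ∑ l ∈ Finset.univ.erase isl1, v l =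
      ∑ i, v (isl2 i) + (∑ i, v (isl3 i) + ∑ i, v (isl4 i)) := by
  have h := Finset.add_sum_erase Finset.univ v (Finset.mem_univ isl1)
  simp only [Fintype.sum_sum_type, Finset.univ_unique, Finset.sum_singleton] at h
  exact add_left_cancel h

/-- Proposition: island anonymity.
Within an island of the malicious agent 1 (blocks `(1, V₂, V₃, V₄)` with `V₂`
nonempty), with island adjacency matrix `A` (nonnegative, zero diagonal, zero
`(1,3)` block), out-degrees `d`, and weight-balanced island Laplacian
`L₁ = diag(d) − A` (`1ᵀL₁ = 0`): the island agents run the perturbed consensus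
dynamics `ẋₗ = −(L₁y)ₗ + fₗ + dₗgₗ`, `y = x + g`, `x(0) = r`; agent 1 runs the
observer `η̇ = −(L₁y)₁`, `η(0) = −Σ_{j≠1}βʲ`, together with
`ζ̇ᵢ = (L₁y)ᵢ`, `ζᵢ(0) = −βⁱ` for each `i ∈ V₄`, and forms
`μ(t) = (η(t) − Σ_{i∈V₄}ζᵢ(t))/n₂₃ + x¹(t)` where `n₂₃ = |V₂| + |V₃|`.
If `∫₀ᵗ (fʲ + dʲgʲ) dτ → βʲ` for every island agent `j ≠ 1` and all states
converge to a common limit, then `μ(t) → (1/n₂₃) Σ_{j∈V₂∪V₃} rʲ`. -/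
theorem island_anonymity_observer
    {n₂ n₃ n₄ : ℕ} (hn₂ : 0 < n₂)
    (A : Matrix (IslandIdx n₂ n₃ n₄) (IslandIdx n₂ n₃ n₄) ℝ)
    (hA : ∀ i j, 0 ≤ A i j) (hAdiag : ∀ i, A i i = 0)
    (hz13 : ∀ j, A isl1 (isl3 j) = 0)
    (hz43 : ∀ i j, A (isl4 i) (isl3 j) = 0)
    (d : IslandIdx n₂ n₃ n₄ → ℝ) (hd : ∀ i, d i = ∑ j, A i j)
    (L₁ : Matrix (IslandIdx n₂ n₃ n₄) (IslandIdx n₂ n₃ n₄) ℝ)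
    (hL₁def : L₁ = Matrix.diagonal d - A)
    (h1L₁ : Matrix.vecMul (fun _ => (1:ℝ)) L₁ = 0)
    (f g : ℝ → IslandIdx n₂ n₃ n₄ → ℝ)
    (hfm : Measurable f) (hgm : Measurable g)
    (hfb : ∃ C : ℝ, ∀ᵐ t : ℝ, 0 ≤ t → ‖f t‖ ≤ C)
    (hgb : ∃ C : ℝ, ∀ᵐ t : ℝ, 0 ≤ t → ‖g t‖ ≤ C)
    (x y : ℝ → IslandIdx n₂ n₃ n₄ → ℝ)
    (hy : ∀ t, y t = x t + g t)
    (hxdyn : ∀ l, l ≠ isl1 → ∀ t : ℝ, 0 ≤ t →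
        HasDerivAt (fun s => x s l) (-(L₁ *ᵥ y t) l + f t l + d l * g t l) t)
    (r : IslandIdx n₂ n₃ n₄ → ℝ) (hr : ∀ l, x 0 l = r l)
    (β : IslandIdx n₂ n₃ n₄ → ℝ)
    (hβ : ∀ l, l ≠ isl1 →
        Tendsto (fun t : ℝ => ∫ τ in (0:ℝ)..t, (f τ l + d l * g τ l))
          atTop (nhds (β l)))
    (hconsensus : ∃ cc : ℝ, ∀ l, Tendsto (fun t : ℝ => x t l) atTop (nhds cc))
    (η : ℝ → ℝ)
    (hη : ∀ t : ℝ, 0 ≤ t → HasDerivAt η (-(L₁ *ᵥ y t) isl1) t)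
    (hη0 : η 0 = -∑ l ∈ Finset.univ.erase isl1, β l)
    (ζ : Fin n₄ → ℝ → ℝ)
    (hζ : ∀ i, ∀ t : ℝ, 0 ≤ t → HasDerivAt (ζ i) ((L₁ *ᵥ y t) (isl4 i)) t)
    (hζ0 : ∀ i, ζ i 0 = -β (isl4 i))
    (μ : ℝ → ℝ)
    (hμ : ∀ t, μ t = (η t - ∑ i, ζ i t) / ((n₂ : ℝ) + n₃) + x t isl1) :
    Tendsto μ atTop
      (nhds ((1 / ((n₂ : ℝ) + n₃)) *
        ((∑ i : Fin n₂, r (isl2 i)) + ∑ i : Fin n₃, r (isl3 i)))) := by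
  obtain ⟨cc, hcc⟩ := hconsensus
  obtain ⟨Cf, hCf⟩ := hfb
  obtain ⟨Cg, hCg⟩ := hgb
  have hint : ∀ l, ∀ t : ℝ, 0 ≤ t →
      IntervalIntegrable (fun τ => f τ l + d l * g τ l) volume 0 t := by
    intro l t ht
    refine IntervalIntegrable.add ?_ (IntervalIntegrable.const_mul ?_ (d l))
    · refine intervalIntegrable_of_ae_bound_nonneg (measurable_pi_iff.mp hfm l) (C := Cf) ?_ ht
      filter_upwards [hCf] with s hs h0 using (norm_le_pi_norm (f s) l).trans (hs h0)
    · refine intervalIntegrable_of_ae_bound_nonneg (measurable_pi_iff.mp hgm l) (C := Cg) ?_ ht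
      filter_upwards [hCg] with s hs h0 using (norm_le_pi_norm (g s) l).trans (hs h0)
  have hbal : ∀ v : IslandIdx n₂ n₃ n₄ → ℝ,
      (L₁ *ᵥ v) isl1 + ∑ l ∈ Finset.univ.erase isl1, (L₁ *ᵥ v) l = 0 := by
    intro v
    rw [Finset.add_sum_erase _ _ (Finset.mem_univ isl1)]
    have h := Matrix.dotProduct_mulVec (fun _ => (1 : ℝ)) L₁ v
    rw [h1L₁, zero_dotProduct] at h
    simpa [dotProduct] using h
  have hlimη : Tendsto η atTop
      (nhds (∑ l ∈ Finset.univ.erase isl1, r l -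
        ∑ _l ∈ Finset.univ.erase (isl1 : IslandIdx n₂ n₃ n₄), cc)) := by
    have hsum := tendsto_of_hasDerivAt_of_tendsto_integral
      (F := fun t => η t + ∑ l ∈ Finset.univ.erase isl1, x t l)
      (h := fun t => ∑ l ∈ Finset.univ.erase isl1, (f t l + d l * g t l))
      (b := ∑ l ∈ Finset.univ.erase isl1, β l)
      (fun t ht => by
        refine ((hη t ht).add (HasDerivAt.fun_sum fun l hl =>
          hxdyn l (Finset.ne_of_mem_erase hl) t ht)).congr_deriv ?_
        simp only [Finset.sum_add_distrib, Finset.sum_neg_distrib]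
        linarith [hbal (y t)])
      (fun t ht => by
        simpa only [Finset.sum_fn] using
          IntervalIntegrable.sum (Finset.univ.erase isl1) fun l _ => hint l t ht)
      (by
        refine (tendsto_finsetSum _ fun l hl => hβ l (Finset.ne_of_mem_erase hl)).congr' ?_
        filter_upwards [eventually_ge_atTop 0] with t ht
        exact (integral_finsetSum fun l _ => hint l t ht).symm)
    have hx := tendsto_finsetSum (Finset.univ.erase (isl1 : IslandIdx n₂ n₃ n₄))
      fun l _ => hcc l
    have hsub := hsum.sub hx
    simp only [hη0, hr, add_sub_cancel_right] at hsub
    convert hsub using 2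
    ring
  have hlimζ : ∀ i, Tendsto (ζ i) atTop (nhds (r (isl4 i) - cc)) := by
    intro i
    have hne : (isl4 i : IslandIdx n₂ n₃ n₄) ≠ isl1 := by simp [isl4, isl1]
    have hsum := tendsto_of_hasDerivAt_of_tendsto_integral
      (F := fun t => ζ i t + x t (isl4 i))
      (fun t ht => ((hζ i t ht).add (hxdyn _ hne t ht)).congr_deriv (by ring))
      (hint _) (hβ _ hne)
    have hsub := hsum.sub (hcc (isl4 i))
    simp only [hζ0, hr, add_sub_cancel_right] at hsub
    convert hsub using 2
    ring
  have hpos : (0 : ℝ) < (n₂ : ℝ) + n₃ := by positivity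
  have hlim := ((hlimη.sub (tendsto_finsetSum Finset.univ fun i _ => hlimζ i)).div_const
    ((n₂ : ℝ) + n₃)).add (hcc isl1)
  rw [funext hμ]
  convert hlim using 2
  rw [sum_erase_isl1 r, sum_erase_isl1 fun _ => cc]
  simp only [Finset.sum_sub_distrib, Finset.sum_const, Finset.card_univ,
    Fintype.card_fin, nsmul_eq_mul]
  field_simp
  ring
end
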